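/- Let X be a Banach function space over (ℝⁿ,dx). Then for every nonnegative measurable function f, ‖Mf‖_X ≤ C·sup_{D,S} ‖A_{D,S}f‖_X, where the supremum is taken over all dyadic grids D in ℝⁿ and all sparse families S⊆D, and C depends only on n. -/

import Mathlib

open MeasureTheory Set Filter
open scoped ENNReal NNReal Topology

noncomputable section

namespace SparseCZ

/-- Euclidean space `ℝⁿ`. -/
abbrev Rn (n : ℕ) := EuclideanSpace ℝ (Fin n)

/-- An axis-parallel (half-open) cube in `ℝⁿ`, recorded by its lower corner and sidelength. -/
structure Cube (n : ℕ) where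
  corner : Fin n → ℝ
  side : ℝ
  side_pos : 0 < side

namespace Cube

variable {n : ℕ}

/-- The set of points of a cube. -/
def toSet (Q : Cube n) : Set (Rn n) :=
  {x | ∀ i, Q.corner i ≤ x i ∧ x i < Q.corner i + Q.side}

/-- `2^m Q`: the cube concentric with `Q` of sidelength `2^m · ℓ_Q`. -/
def dilatePow (Q : Cube n) (m : ℕ) : Cube n where
  corner := fun i => Q.corner i + Q.side / 2 - 2 ^ m * Q.side / 2
  side := 2 ^ m * Q.side
  side_pos := by have := Q.side_pos; positivity

end Cube

variable {n : ℕ}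

/-- A dyadic grid in `ℝⁿ`: cubes of sidelengths `2^k`, pairwise intersections are one of the two
cubes or empty, and the cubes of each fixed sidelength partition `ℝⁿ`. -/
def IsDyadicGrid (D : Set (Cube n)) : Prop :=
  (∀ Q ∈ D, ∃ k : ℤ, Q.side = 2 ^ k) ∧
  (∀ Q ∈ D, ∀ R ∈ D,
    Q.toSet ∩ R.toSet = Q.toSet ∨ Q.toSet ∩ R.toSet = R.toSet ∨ Q.toSet ∩ R.toSet = ∅) ∧
  (∀ k : ℤ, ∀ x : Rn n, ∃! Q : Cube n, Q ∈ D ∧ Q.side = 2 ^ k ∧ x ∈ Q.toSet)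

/-- A sparse family of cubes. -/
def IsSparse (S : Set (Cube n)) : Prop :=
  ∀ Q ∈ S, volume (⋃ P ∈ {P | P ∈ S ∧ P.toSet ⊂ Q.toSet}, Cube.toSet P) ≤ volume Q.toSet / 2

/-- Average `|s|⁻¹ ∫_s f` of an `ℝ≥0∞`-valued function. -/
def avgE (s : Set (Rn n)) (f : Rn n → ℝ≥0∞) : ℝ≥0∞ :=
  (volume s)⁻¹ * ∫⁻ x in s, f x

/-- The Hardy–Littlewood maximal operator over (axis-parallel) cubes. -/
def hlMax (f : Rn n → ℝ≥0∞) (x : Rn n) : ℝ≥0∞ :=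
  ⨆ (Q : Cube n) (_ : x ∈ Q.toSet), avgE Q.toSet f

/-- Sparse operator `A_{D,S} f = Σ_{Q∈S} f_Q χ_Q`. -/
def sparseOp (S : Set (Cube n)) (f : Rn n → ℝ≥0∞) (x : Rn n) : ℝ≥0∞ :=
  ∑' Q : S, Set.indicator (Q.1.toSet) (fun _ => avgE Q.1.toSet f) x

/-- Shifted sparse operator `T_{S,m} f = Σ_{Q∈S} f_{2^m Q} χ_Q`. -/
def sparseOpShift (S : Set (Cube n)) (m : ℕ) (f : Rn n → ℝ≥0∞) (x : Rn n) : ℝ≥0∞ :=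
  ∑' Q : S, Set.indicator (Q.1.toSet) (fun _ => avgE (Q.1.dilatePow m).toSet f) x

/-- The median `m_Q(g)` of a function over a cube. -/
def median (g : Rn n → ℝ) (Q : Cube n) : ℝ :=
  sSup {l : ℝ | volume {x ∈ Q.toSet | l < g x} ≤ volume Q.toSet / 2 ∧
                volume {x ∈ Q.toSet | g x < l} ≤ volume Q.toSet / 2}

/-- A weight: a positive, measurable, locally integrable function. -/
def IsWeight (w : Rn n → ℝ) : Prop :=
  Measurable w ∧ (∀ x, 0 < w x) ∧ LocallyIntegrable w volume

/-- `w(s) = ∫_s w`. -/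
def wInt (w : Rn n → ℝ) (s : Set (Rn n)) : ℝ≥0∞ :=
  ∫⁻ x in s, ENNReal.ofReal (w x)

/-- The measure `w·dx`. -/
def wMeasure (w : Rn n → ℝ) : Measure (Rn n) :=
  volume.withDensity fun x => ENNReal.ofReal (w x)

/-- The Muckenhoupt `A_p` characteristic `[w]_{A_p}`. -/
def ApConst (n : ℕ) (p : ℝ) (w : Rn n → ℝ) : ℝ≥0∞ :=
  ⨆ Q : Cube n,
    avgE Q.toSet (fun x => ENNReal.ofReal (w x)) *
      (avgE Q.toSet fun x => ENNReal.ofReal (w x ^ (1 - p / (p - 1)))) ^ (p - 1)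

/-- The Fujii–Wilson `A_∞` characteristic `[w]_{A_∞}`. -/
def AinftyConst (n : ℕ) (w : Rn n → ℝ) : ℝ≥0∞ :=
  ⨆ Q : Cube n,
    (wInt w Q.toSet)⁻¹ *
      ∫⁻ x in Q.toSet, hlMax (fun y => ENNReal.ofReal (Set.indicator Q.toSet w y)) x

/-- The weighted dyadic maximal operator `M^D_w`. -/
def dyadicMaxW (D : Set (Cube n)) (w : Rn n → ℝ) (f : Rn n → ℝ≥0∞) (x : Rn n) : ℝ≥0∞ :=
  ⨆ (Q : Cube n) (_ : Q ∈ D) (_ : x ∈ Q.toSet),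
    (wInt w Q.toSet)⁻¹ * ∫⁻ y in Q.toSet, f y * ENNReal.ofReal (w y)

/-- A Calderón–Zygmund operator `T` with standard kernel `K` (constant `c`, smoothness `δ`). -/
structure IsCZO (n : ℕ) (T : (Rn n → ℝ) → Rn n → ℝ)
    (K : Rn n → Rn n → ℝ) (c δ : ℝ) : Prop where
  c_pos : 0 < c
  delta_pos : 0 < δ
  delta_le_one : δ ≤ 1
  size : ∀ x y, x ≠ y → |K x y| ≤ c / dist x y ^ n
  smooth : ∀ x x' y : Rn n, x ≠ y → dist x x' ≤ dist x y / 2 →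
    |K x y - K x' y| + |K y x - K y x'| ≤ c * dist x x' ^ δ / dist x y ^ ((n : ℝ) + δ)
  linear : IsLinearMap ℝ T
  l2_bounded : ∃ A : ℝ≥0∞, A ≠ ⊤ ∧ ∀ f, eLpNorm (T f) 2 volume ≤ A * eLpNorm f 2 volume
  repr : ∀ f : Rn n → ℝ, Integrable f volume → ∀ x ∉ tsupport f, T f x = ∫ y, K x y * f y

/-- The maximal truncated operator `T**` associated with a kernel `K`. -/
def maxTrunc (K : Rn n → Rn n → ℝ) (f : Rn n → ℝ) (x : Rn n) : ℝ :=
  ⨆ e : {e : ℝ × ℝ // 0 < e.1 ∧ e.1 < e.2},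
    |∫ y in {y | e.1.1 < dist x y ∧ dist x y < e.1.2}, K x y * f y|

/-- The `L¹ → L^{1,∞}` operator (quasi-)norm `sup {λ·|{|Uf|>λ}| : λ>0, ‖f‖₁ ≤ 1}`. -/
def weakNorm11 (U : (Rn n → ℝ) → Rn n → ℝ) : ℝ≥0∞ :=
  ⨆ (f : Rn n → ℝ) (_ : eLpNorm f 1 volume ≤ 1) (l : {l : ℝ // 0 < l}),
    ENNReal.ofReal l.1 * volume {x | l.1 < |U f x|}

/-- A Banach function space over `(ℝⁿ, dx)` (rearrangement invariance not required),
described by its function norm `ρ` acting on nonnegative (`ℝ≥0∞`-valued) functions. -/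
structure BFS (n : ℕ) where
  ρ : (Rn n → ℝ≥0∞) → ℝ≥0∞
  zero_iff : ∀ f, ρ f = 0 ↔ f =ᵐ[volume] 0
  add_le : ∀ f g, ρ (fun x => f x + g x) ≤ ρ f + ρ g
  smul_eq : ∀ (a : ℝ≥0) (f), ρ (fun x => (a : ℝ≥0∞) * f x) = a * ρ f
  mono : ∀ f g, f ≤ᵐ[volume] g → ρ f ≤ ρ g
  fatou : ∀ f : ℕ → Rn n → ℝ≥0∞, Monotone f → ρ (fun x => ⨆ k, f k x) = ⨆ k, ρ (f k)
  indicator_lt_top : ∀ E : Set (Rn n), MeasurableSet E → volume E < ⊤ → ρ (E.indicator 1) < ⊤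
  setIntegral_le : ∀ E : Set (Rn n), MeasurableSet E → volume E < ⊤ →
    ∃ C : ℝ≥0∞, C ≠ ⊤ ∧ ∀ f, ∫⁻ x in E, f x ≤ C * ρ f

/-- The decreasing rearrangement of `f` with respect to the measure `μ`. -/
def rearr {α : Type*} [MeasurableSpace α] (μ : Measure α) (f : α → ℝ≥0∞) (t : ℝ) : ℝ≥0∞ :=
  sInf {l : ℝ≥0∞ | μ {x | l < f x} ≤ ENNReal.ofReal t}

/-- Lebesgue measure on `(0,∞)`. -/
def lebPos : Measure ℝ := volume.restrict (Set.Ioi 0)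

/-- A rearrangement invariant quasi-Banach function space, given (via the Luxemburg
representation) by its function quasi-norm `ρ` over `(ℝ⁺, dt)`; the (weighted) norm of a
function on `ℝⁿ` is `ρ` applied to its decreasing rearrangement. -/
structure RIQBFS where
  ρ : (ℝ → ℝ≥0∞) → ℝ≥0∞
  quasi_triangle : ∃ Cq : ℝ≥0∞, 1 ≤ Cq ∧ Cq ≠ ⊤ ∧
    ∀ f g, ρ (fun t => f t + g t) ≤ Cq * (ρ f + ρ g)
  smul_eq : ∀ (a : ℝ≥0) (f), ρ (fun t => (a : ℝ≥0∞) * f t) = a * ρ f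
  zero_iff : ∀ f, ρ f = 0 ↔ f =ᵐ[lebPos] 0
  mono : ∀ f g, f ≤ᵐ[lebPos] g → ρ f ≤ ρ g
  fatou : ∀ f : ℕ → ℝ → ℝ≥0∞, Monotone f → ρ (fun t => ⨆ k, f k t) = ⨆ k, ρ (f k)
  rearr_invariant : ∀ f g,
    (∀ l : ℝ≥0∞, lebPos {t | l < f t} = lebPos {t | l < g t}) → ρ f = ρ g

namespace RIQBFS

/-- The norm of `X(w)`: `‖f‖_{X(w)} = ρ(f*_w)`. -/
def normW (X : RIQBFS) {n : ℕ} (w : Rn n → ℝ) (f : Rn n → ℝ≥0∞) : ℝ≥0∞ :=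
  X.ρ (rearr (wMeasure w) f)

/-- The (unweighted) norm of `X`: `‖f‖_X = ρ(f*)`. -/
def normV (X : RIQBFS) {n : ℕ} (f : Rn n → ℝ≥0∞) : ℝ≥0∞ :=
  X.ρ (rearr (volume : Measure (Rn n)) f)

/-- `h_X(t)`: the operator norm of the dilation `D_t f(s) = f(s/t)` on `X̄`. -/
def dilNorm (X : RIQBFS) (t : ℝ) : ℝ≥0∞ :=
  ⨆ (f : ℝ → ℝ≥0∞) (_ : X.ρ f ≤ 1), X.ρ fun s => f (s / t)

/-- The lower Boyd index `p_X = sup_{1<t<∞} log t / log h_X(t)`. -/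
def boydLower (X : RIQBFS) : ℝ :=
  ⨆ t : {t : ℝ // 1 < t}, Real.log t.1 / Real.log (X.dilNorm t.1).toReal

/-- The upper Boyd index `q_X = inf_{0<t<1} log t / log h_X(t)`. -/
def boydUpper (X : RIQBFS) : ℝ :=
  ⨅ t : {t : ℝ // 0 < t ∧ t < 1}, Real.log t.1 / Real.log (X.dilNorm t.1).toReal

/-- `p`-convexity of `X` (as a space of functions on `ℝⁿ`). -/
def pConvex (X : RIQBFS) (n : ℕ) (p : ℝ) : Prop :=
  ∃ C : ℝ≥0∞, C ≠ ⊤ ∧ ∀ (N : ℕ) (f : Fin N → Rn n → ℝ≥0∞),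
    X.normV (fun x : Rn n => (∑ j, f j x ^ p) ^ (1 / p)) ≤
      C * (∑ j, X.normV (f j) ^ p) ^ (1 / p)

end RIQBFS

/-- A rearrangement invariant Banach function space: an RIQBFS whose quasi-norm is an actual
norm satisfying the Banach function space axioms. -/
structure RIBFS extends RIQBFS where
  add_le : ∀ f g, ρ (fun t => f t + g t) ≤ ρ f + ρ g
  indicator_lt_top : ∀ E : Set ℝ, MeasurableSet E → lebPos E < ⊤ → ρ (E.indicator 1) < ⊤
  setIntegral_le : ∀ E : Set ℝ, MeasurableSet E → lebPos E < ⊤ →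
    ∃ C : ℝ≥0∞, C ≠ ⊤ ∧ ∀ f, ∫⁻ t in E, f t ∂lebPos ≤ C * ρ f

/-- The class `Φ`: nonnegative increasing functions on `[0,∞)` with `φ(0⁺)=0`, `φ(∞)=∞`. -/
def PhiClass (φ : ℝ → ℝ) : Prop :=
  (∀ ⦃s t : ℝ⦄, 0 ≤ s → s ≤ t → φ s ≤ φ t) ∧ (∀ t, 0 ≤ t → 0 ≤ φ t) ∧
  Tendsto φ (nhdsWithin 0 (Set.Ioi 0)) (nhds 0) ∧ Tendsto φ atTop atTop

/-- Quasi-convexity: `ψ(t) ≤ φ(t) ≤ a·ψ(a·t)` for some convex `ψ` and `a ≥ 1`. -/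
def QuasiConvexPhi (φ : ℝ → ℝ) : Prop :=
  ∃ (ψ : ℝ → ℝ) (a : ℝ), 1 ≤ a ∧ ConvexOn ℝ (Set.Ici 0) ψ ∧
    ∀ t, 0 ≤ t → ψ t ≤ φ t ∧ φ t ≤ a * ψ (a * t)

/-- `h_φ(t) = sup_{s>0} φ(st)/φ(s)`. -/
def hphi (φ : ℝ → ℝ) (t : ℝ) : ℝ :=
  ⨆ s : {s : ℝ // 0 < s}, φ (s.1 * t) / φ s.1

/-- The lower dilation index `i_φ = sup_{0<t<1} log h_φ(t)/log t`. -/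
def iphi (φ : ℝ → ℝ) : ℝ :=
  ⨆ t : {t : ℝ // 0 < t ∧ t < 1}, Real.log (hphi φ t.1) / Real.log t.1

/-- The upper dilation index `I_φ = inf_{1<t} log h_φ(t)/log t`. -/
def IphiUpper (φ : ℝ → ℝ) : ℝ :=
  ⨅ t : {t : ℝ // 1 < t}, Real.log (hphi φ t.1) / Real.log t.1

/-- An `N`-function. -/
def IsNFunction (φ : ℝ → ℝ) : Prop :=
  ConvexOn ℝ (Set.Ici 0) φ ∧ (∀ ⦃s t : ℝ⦄, 0 ≤ s → s ≤ t → φ s ≤ φ t) ∧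
  (∀ t, 0 ≤ t → 0 ≤ φ t) ∧ φ 0 = 0 ∧
  Tendsto (fun t => φ t / t) (nhdsWithin 0 (Set.Ioi 0)) (nhds 0) ∧
  Tendsto (fun t => φ t / t) atTop atTop

/-- The complementary (Young conjugate) function `φ̄(s) = sup_{t>0} (st − φ(t))`. -/
def complementary (φ : ℝ → ℝ) (s : ℝ) : ℝ :=
  ⨆ t : {t : ℝ // 0 < t}, (s * t.1 - φ t.1)

/-- The modular `ρ_w^φ(g) = ∫ φ(g(x)) w(x) dx` for a nonnegative (`ℝ≥0∞`-valued) `g`. -/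
def modularE (φ : ℝ → ℝ) (w : Rn n → ℝ) (g : Rn n → ℝ≥0∞) : ℝ≥0∞ :=
  ∫⁻ x, ENNReal.ofReal (φ (g x).toReal) * ENNReal.ofReal (w x)

end SparseCZ

namespace SparseCZ

section Aux

variable {n : ℕ}

lemma toSet_eq (Q : Cube n) : Q.toSet = (WithLp.ofLp : Rn n → (Fin n → ℝ)) ⁻¹'
    (Set.pi univ fun i => Ico (Q.corner i) (Q.corner i + Q.side)) := by
  ext x; simp [Cube.toSet, Set.mem_pi]

lemma measurableSet_toSet (Q : Cube n) : MeasurableSet Q.toSet := by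
  rw [toSet_eq]
  exact (PiLp.volume_preserving_ofLp (Fin n)).measurable
    (MeasurableSet.univ_pi fun i => measurableSet_Ico)

lemma volume_toSet (Q : Cube n) : volume Q.toSet = ENNReal.ofReal Q.side ^ n := by
  rw [toSet_eq, (PiLp.volume_preserving_ofLp (Fin n)).measure_preimage
    (MeasurableSet.univ_pi fun i => measurableSet_Ico).nullMeasurableSet, Real.volume_pi_Ico]
  simp

lemma volume_ne_zero (Q : Cube n) : volume Q.toSet ≠ 0 := by
  rw [volume_toSet]
  exact pow_ne_zero _ (by simpa using Q.side_pos)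

lemma volume_ne_top (Q : Cube n) : volume Q.toSet ≠ ⊤ := by
  rw [volume_toSet]
  exact ENNReal.pow_ne_top ENNReal.ofReal_ne_top

/-- sign -/
def sg (k : ℤ) : ℤ := if Even k then 1 else -1

lemma sg_succ (k : ℤ) : sg (k + 1) = - sg k := by
  unfold sg
  by_cases h : Even k <;> simp [h]

/-- integer valued thrice the shift -/
def sh (t : Fin n → Bool) (k : ℤ) (i : Fin n) : ℤ := if t i then sg k else 0

lemma sh_succ (t : Fin n → Bool) (k : ℤ) (i : Fin n) : sh t (k + 1) i = - sh t k i := by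
  unfold sh; split_ifs <;> simp [sg_succ]

/-- grid cubes -/
def gc (t : Fin n → Bool) (k : ℤ) (m : Fin n → ℤ) : Cube n where
  corner := fun i => 2 ^ k * (m i + (sh t k i : ℝ) / 3)
  side := 2 ^ k
  side_pos := by positivity

/-- index of the grid cube containing a point -/
def fl (t : Fin n → Bool) (k : ℤ) (x : Rn n) (i : Fin n) : ℤ :=
  ⌊x i / 2 ^ k - (sh t k i : ℝ) / 3⌋

lemma mem_gc (t : Fin n → Bool) (k : ℤ) (m : Fin n → ℤ) (x : Rn n) :
    x ∈ (gc t k m).toSet ↔ fl t k x = m := by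
  rw [funext_iff]
  simp only [Cube.toSet, gc, fl, mem_ofPred_eq, Int.floor_eq_iff]
  refine forall_congr' fun i => ?_
  have h : (0:ℝ) < 2 ^ k := by positivity
  have e : x i = 2 ^ k * (x i / 2 ^ k) := by field_simp
  generalize x i / 2 ^ k = u at *
  rw [e, show (2:ℝ) ^ k * (m i + (sh t k i : ℝ) / 3) + 2 ^ k
    = 2 ^ k * (m i + (sh t k i : ℝ) / 3 + 1) by ring, mul_le_mul_iff_right₀ h,
    mul_lt_mul_iff_right₀ h]
  constructor <;> rintro ⟨h1, h2⟩ <;> constructor <;> linarith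

/-- grid cube around a point -/
def qx (t : Fin n → Bool) (k : ℤ) (x : Rn n) : Cube n := gc t k (fl t k x)

lemma mem_qx (t : Fin n → Bool) (k : ℤ) (x y : Rn n) :
    y ∈ (qx t k x).toSet ↔ fl t k y = fl t k x := mem_gc _ _ _ _

lemma fl_succ (t : Fin n → Bool) (k : ℤ) (x : Rn n) (i : Fin n) :
    fl t (k + 1) x i = (fl t k x i + sh t k i) / 2 := by
  unfold fl
  rw [sh_succ, Int.floor_eq_iff, zpow_add_one₀ (by norm_num)]
  have e : x i / (2 ^ k * 2) = (x i / 2 ^ k) / 2 := by rw [div_div]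
  rw [e]
  generalize x i / 2 ^ k = u
  set z := sh t k i
  have h1 := Int.floor_le (u - (z:ℝ) / 3)
  have h2 := Int.lt_floor_add_one (u - (z:ℝ) / 3)
  set F := ⌊u - (z:ℝ) / 3⌋
  have h3 : 2 * ((F + z) / 2) ≤ F + z := by omega
  have h4 : F + z + 1 ≤ 2 * ((F + z) / 2) + 2 := by omega
  have h3' : (2:ℝ) * (((F + z) / 2 : ℤ) : ℝ) ≤ F + z := by exact_mod_cast h3
  have h4' : (F:ℝ) + z + 1 ≤ 2 * (((F + z) / 2 : ℤ) : ℝ) + 2 := by exact_mod_cast h4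
  push_cast
  constructor <;> linarith

lemma fl_nest (t : Fin n → Bool) (k : ℤ) (j : ℕ) (x y : Rn n) (h : fl t k x = fl t k y) :
    fl t (k + j) x = fl t (k + j) y := by
  induction j with
  | zero => simpa using h
  | succ j ih =>
    push_cast
    rw [← add_assoc]
    ext i
    rw [fl_succ, fl_succ, ih]

lemma fl_nest' (t : Fin n → Bool) {k l : ℤ} (hkl : k ≤ l) {x y : Rn n}
    (h : fl t k x = fl t k y) : fl t l x = fl t l y := by
  obtain ⟨j, rfl⟩ := Int.le.dest hkl
  exact fl_nest t k j x y h

/-- the grid -/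
def grid (t : Fin n → Bool) : Set (Cube n) := {Q | ∃ k x, Q = qx t k x}

lemma grid_aux (t : Fin n → Bool) {k l : ℤ} (hkl : k ≤ l) (x y : Rn n) :
    (qx t k x).toSet ∩ (qx t l y).toSet = (qx t k x).toSet ∨
    (qx t k x).toSet ∩ (qx t l y).toSet = ∅ := by
  rcases Set.eq_empty_or_nonempty ((qx t k x).toSet ∩ (qx t l y).toSet) with h | ⟨z, hz1, hz2⟩
  · exact Or.inr h
  · left
    rw [inter_eq_left]
    intro w hw
    rw [mem_qx] at *
    rw [← hz2]
    exact fl_nest' t hkl (hw.trans hz1.symm)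

lemma grid_isDyadic (t : Fin n → Bool) : IsDyadicGrid (grid t) := by
  refine ⟨?_, ?_, ?_⟩
  · rintro Q ⟨k, x, rfl⟩
    exact ⟨k, rfl⟩
  · rintro Q ⟨k, x, rfl⟩ R ⟨l, y, rfl⟩
    rcases le_total k l with h | h
    · have := grid_aux t h x y
      tauto
    · have := grid_aux t h y x
      rw [inter_comm] at this
      tauto
  · intro k x
    refine ⟨qx t k x, ⟨⟨k, x, rfl⟩, rfl, (mem_qx ..).2 rfl⟩, ?_⟩
    rintro Q ⟨⟨l, y, rfl⟩, h2, h3⟩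
    have hl : l = k := zpow_right_injective₀ (a := (2:ℝ)) (by norm_num) (by norm_num) h2
    subst hl
    rw [mem_qx] at h3
    unfold qx
    rw [h3]

lemma grid_countable (t : Fin n → Bool) : (grid t).Countable := by
  refine (Set.countable_range (fun p : ℤ × (Fin n → ℤ) => gc t p.1 p.2)).mono ?_
  rintro Q ⟨k, x, rfl⟩
  exact ⟨(k, fl t k x), rfl⟩

/-- one-third trick in one dimension -/
lemma third_aux (z : ℤ) (a b : ℝ) (h : ¬ ∀ u v : ℝ, a ≤ u → u < b → a ≤ v → v < b →
    ⌊u - (z:ℝ) / 3⌋ = ⌊v - (z:ℝ) / 3⌋) : ∃ m : ℤ, 3 * a < 3 * m + z ∧ (3 * m + z : ℝ) < 3 * b := by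
  push Not at h
  obtain ⟨u, v, h1, h2, h3, h4, h5⟩ := h
  wlog hlt : ⌊u - (z:ℝ) / 3⌋ < ⌊v - (z:ℝ) / 3⌋ generalizing u v
  · exact this v u h3 h4 h1 h2 h5.symm (lt_of_le_of_ne (not_lt.1 hlt) h5.symm)
  refine ⟨⌊v - (z:ℝ) / 3⌋, ?_, ?_⟩
  · have := Int.floor_lt.1 hlt
    linarith
  · have := Int.floor_le (v - (z:ℝ) / 3)
    linarith

lemma third (e : ℤ) (he : e = 1 ∨ e = -1) (a b : ℝ) (hab : b - a ≤ 1 / 3) :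
    ∃ c : Bool, ∀ u v : ℝ, a ≤ u → u < b → a ≤ v → v < b →
    ⌊u - ((if c then e else 0 : ℤ) : ℝ) / 3⌋ = ⌊v - ((if c then e else 0 : ℤ) : ℝ) / 3⌋ := by
  by_contra hc
  rw [not_exists] at hc
  obtain ⟨m, h1, h2⟩ := third_aux _ _ _ (hc false)
  obtain ⟨m', h3, h4⟩ := third_aux _ _ _ (hc true)
  simp only [Bool.false_eq_true, if_false, if_true, Int.cast_zero, add_zero] at h1 h2 h3 h4
  have h5 : ((3 * m : ℤ) : ℝ) < ((3 * m' + e + 1 : ℤ) : ℝ) := by push_cast; linarith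
  have h6 : ((3 * m' + e : ℤ) : ℝ) < ((3 * m + 1 : ℤ) : ℝ) := by push_cast; linarith
  rw [Int.cast_lt] at h5 h6
  omega

lemma cover (Q : Cube n) : ∃ (t : Fin n → Bool) (k : ℤ), (2:ℝ) ^ k ≤ 6 * Q.side ∧
    ∀ x ∈ Q.toSet, Q.toSet ⊆ (qx t k x).toSet := by
  obtain ⟨k', hk1, hk2⟩ := exists_mem_Ioc_zpow (x := 3 * Q.side) (y := (2:ℝ))
    (by have := Q.side_pos; positivity) (by norm_num)
  set k := k' + 1 with hk
  have hk3 : (2:ℝ) ^ k ≤ 6 * Q.side := by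
    rw [hk, zpow_add_one₀ (by norm_num)]; linarith
  have hpos : (0:ℝ) < 2 ^ k := by positivity
  have hsg : sg k = 1 ∨ sg k = -1 := by unfold sg; split_ifs <;> simp
  have hlen : ∀ i, (Q.corner i + Q.side) / 2 ^ k - Q.corner i / 2 ^ k ≤ 1 / 3 := by
    intro i
    rw [← sub_div, add_sub_cancel_left, div_le_div_iff₀ hpos (by norm_num)]
    linarith
  choose t ht using fun i => third (sg k) hsg _ _ (hlen i)
  refine ⟨t, k, hk3, fun x hx y hy => ?_⟩
  rw [mem_qx]
  ext i
  exact ht i _ _ (by gcongr; exact (hy i).1) (by gcongr; exact (hy i).2)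
    (by gcongr; exact (hx i).1) (by gcongr; exact (hx i).2)

/-- truncated dyadic maximal function -/
def tM (t : Fin n → Bool) (f : Rn n → ℝ≥0∞) (N : ℕ) (x : Rn n) : ℝ≥0∞ :=
  ⨆ (k : ℤ) (_ : k ≤ N), avgE (qx t k x).toSet f

lemma hlMax_le (f : Rn n → ℝ≥0∞) (x : Rn n) :
    hlMax f x ≤ 6 ^ n * ∑ t : Fin n → Bool, ⨆ N, tM t f N x := by
  refine iSup₂_le fun Q hx => ?_
  obtain ⟨t, k, hk, hsub⟩ := cover Q
  have hsub := hsub x hx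
  have hvol : volume (qx t k x).toSet ≤ 6 ^ n * volume Q.toSet := by
    rw [volume_toSet, volume_toSet, ← mul_pow]
    gcongr
    have : (6:ℝ≥0∞) = ENNReal.ofReal 6 := by norm_num
    rw [this, ← ENNReal.ofReal_mul (by norm_num)]
    exact ENNReal.ofReal_le_ofReal hk
  have h1 : avgE Q.toSet f ≤ 6 ^ n * avgE (qx t k x).toSet f := by
    unfold avgE
    rw [← mul_assoc]
    gcongr
    rw [ENNReal.inv_le_iff_inv_le, ENNReal.mul_inv (by simp) (by simp), inv_inv, mul_comm,
      ← div_eq_mul_inv]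
    exact ENNReal.div_le_of_le_mul' hvol
  refine h1.trans ?_
  gcongr
  calc avgE (qx t k x).toSet f ≤ tM t f k.toNat x :=
        le_iSup₂_of_le k (Int.self_le_toNat k) le_rfl
    _ ≤ ⨆ N, tM t f N x := le_iSup (fun N => tM t f N x) _
    _ ≤ _ := Finset.single_le_sum (f := fun t => ⨆ N, tM t f N x) (fun _ _ => zero_le)
        (Finset.mem_univ t)

/-- decreasing chain -/
def ch (t : Fin n → Bool) (N : ℕ) (j : ℕ) (x : Rn n) : Cube n := qx t ((N:ℤ) - j) x

lemma mem_self_ch (t : Fin n → Bool) (N j : ℕ) (x : Rn n) : x ∈ (ch t N j x).toSet :=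
  (mem_qx ..).2 rfl

lemma ch_eq_of_mem (t : Fin n → Bool) (N : ℕ) {i j : ℕ} (hij : i ≤ j) {x y : Rn n}
    (h : y ∈ (ch t N j x).toSet) : ch t N i y = ch t N i x := by
  have := fl_nest' t (l := (N:ℤ) - i) (by omega) ((mem_qx ..).1 h)
  unfold ch qx
  rw [this]

lemma ch_sub (t : Fin n → Bool) (N : ℕ) {i j : ℕ} (hij : i ≤ j) (x : Rn n) :
    (ch t N j x).toSet ⊆ (ch t N i x).toSet := by
  intro y hy
  rw [← ch_eq_of_mem t N hij hy]
  exact mem_self_ch _ _ _ _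

/-- stopping values -/
def sv (t : Fin n → Bool) (f : Rn n → ℝ≥0∞) (N : ℕ) : ℕ → Rn n → ℝ≥0∞
  | 0, x => avgE (ch t N 0 x).toSet f
  | j + 1, x => if 2 * sv t f N j x < avgE (ch t N (j + 1) x).toSet f
      then avgE (ch t N (j + 1) x).toSet f else sv t f N j x

/-- stopping condition -/
def stp (t : Fin n → Bool) (f : Rn n → ℝ≥0∞) (N : ℕ) : ℕ → Rn n → Prop
  | 0, _ => True
  | j + 1, x => 2 * sv t f N j x < avgE (ch t N (j + 1) x).toSet f

/-- the sparse family -/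
def fam (t : Fin n → Bool) (f : Rn n → ℝ≥0∞) (N : ℕ) : Set (Cube n) :=
  {Q | ∃ j x, stp t f N j x ∧ Q = ch t N j x}

variable (t : Fin n → Bool) (f : Rn n → ℝ≥0∞) (N : ℕ)

lemma sv_congr (j : ℕ) {x y : Rn n} (h : y ∈ (ch t N j x).toSet) :
    sv t f N j y = sv t f N j x := by
  induction j with
  | zero => simp only [sv]; rw [ch_eq_of_mem t N le_rfl h]
  | succ j ih =>
    simp only [sv]
    rw [ih (ch_sub t N (Nat.le_succ j) x h), ch_eq_of_mem t N le_rfl h]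

lemma stp_congr (j : ℕ) {x y : Rn n} (h : y ∈ (ch t N j x).toSet) :
    stp t f N j y ↔ stp t f N j x := by
  cases j with
  | zero => simp [stp]
  | succ j =>
    simp only [stp]
    rw [sv_congr t f N j (ch_sub t N (Nat.le_succ j) x h), ch_eq_of_mem t N le_rfl h]

lemma sv_of_stp (j : ℕ) {x : Rn n} (h : stp t f N j x) :
    sv t f N j x = avgE (ch t N j x).toSet f := by
  cases j with
  | zero => rfl
  | succ j => exact if_pos h

lemma sv_mono (x : Rn n) : Monotone fun j => sv t f N j x := by
  refine monotone_nat_of_le_succ fun j => ?_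
  simp only [sv]
  split_ifs with h
  · refine le_trans ?_ h.le
    rw [two_mul]
    exact le_self_add
  · exact le_rfl

lemma avg_le_sv (j : ℕ) (x : Rn n) : avgE (ch t N j x).toSet f ≤ 2 * sv t f N j x := by
  cases j with
  | zero => simp only [sv]; rw [two_mul]; exact le_self_add
  | succ j =>
    simp only [sv]
    split_ifs with h
    · rw [two_mul]; exact le_self_add
    · exact not_lt.1 h

lemma sv_eq (j : ℕ) (x : Rn n) : ∃ i, stp t f N i x ∧ sv t f N j x = avgE (ch t N i x).toSet f := by
  induction j with
  | zero => exact ⟨0, trivial, rfl⟩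
  | succ j ih =>
    by_cases h : stp t f N (j + 1) x
    · exact ⟨j + 1, h, sv_of_stp t f N _ h⟩
    · obtain ⟨i, h1, h2⟩ := ih
      refine ⟨i, h1, ?_⟩
      rw [← h2]
      exact if_neg h

lemma sv_le_sparse (j : ℕ) (x : Rn n) : sv t f N j x ≤ sparseOp (fam t f N) f x := by
  obtain ⟨i, h1, h2⟩ := sv_eq t f N j x
  rw [h2]
  unfold sparseOp
  refine le_trans ?_ (ENNReal.le_tsum (⟨ch t N i x, i, x, h1, rfl⟩ : fam t f N))
  simp only
  rw [Set.indicator_of_mem (mem_self_ch _ _ _ _)]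

lemma tM_le_sparse (x : Rn n) : tM t f N x ≤ 2 * sparseOp (fam t f N) f x := by
  refine iSup₂_le fun k hk => ?_
  obtain ⟨j, hj⟩ := Int.le.dest hk
  have : k = (N:ℤ) - j := by omega
  subst this
  refine (avg_le_sv t f N j x).trans ?_
  gcongr
  exact sv_le_sparse ..

lemma fam_strict {P Q : Cube n} (hP : P ∈ fam t f N) (hQ : Q ∈ fam t f N)
    (h : P.toSet ⊂ Q.toSet) : 2 * avgE Q.toSet f < avgE P.toSet f := by
  obtain ⟨i, x, hi, rfl⟩ := hP
  obtain ⟨j, y, hj, rfl⟩ := hQ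
  have hxy : x ∈ (ch t N j y).toSet := h.1 (mem_self_ch _ _ _ _)
  have hji : j < i := by
    by_contra hc
    apply h.2
    rw [← ch_eq_of_mem t N le_rfl hxy]
    exact ch_sub t N (not_lt.1 hc) x
  rw [← sv_of_stp t f N j hj, ← sv_congr t f N j hxy]
  obtain ⟨i, rfl⟩ : ∃ i', i = i' + 1 := ⟨i - 1, by omega⟩
  refine lt_of_le_of_lt ?_ hi
  gcongr
  exact sv_mono t f N x (by omega)

lemma fam_sub : fam t f N ⊆ grid t := by
  rintro Q ⟨j, x, -, rfl⟩
  exact ⟨_, x, rfl⟩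

/-- Weak type estimate. -/
lemma weak (Q : Cube n) (F : Set (Cube n)) (hF : ∀ P ∈ F, ∃ j x, P = ch t N j x)
    (hsub : ∀ P ∈ F, P.toSet ⊆ Q.toSet)
    (hlt : ∀ P ∈ F, 2 * avgE Q.toSet f < avgE P.toSet f) :
    volume (⋃ P ∈ F, P.toSet) ≤ volume Q.toSet / 2 := by
  classical
  rcases F.eq_empty_or_nonempty with rfl | ⟨P₀, hP₀⟩
  · simp
  have hne_top : avgE Q.toSet f ≠ ⊤ := by
    intro h
    have := hlt _ hP₀
    simp [h] at this
  have hne_zero : avgE Q.toSet f ≠ 0 := by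
    intro h
    have h2 := hlt _ hP₀
    have h0 : ∫⁻ x in Q.toSet, f x = 0 := by
      unfold avgE at h
      rcases mul_eq_zero.1 h with h | h
      · exact absurd (ENNReal.inv_eq_zero.1 h) (volume_ne_top Q)
      · exact h
    have h1 : ∫⁻ x in P₀.toSet, f x = 0 :=
      le_antisymm ((lintegral_mono_set (hsub _ hP₀)).trans h0.le) zero_le
    simp [avgE, h0, h1] at h2
  set F' : Set (Cube n) := {P | ∃ j x, P = ch t N j x ∧ P ∈ F ∧ ∀ i < j, ch t N i x ∉ F}
  have hcount : F'.Countable := by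
    refine (grid_countable t).mono ?_
    rintro P ⟨j, x, rfl, -⟩
    exact ⟨_, x, rfl⟩
  have hdisj : F'.PairwiseDisjoint Cube.toSet := by
    rintro P ⟨i, x, rfl, h1, h2⟩ R ⟨j, y, rfl, h3, h4⟩ hne
    rw [Function.onFun, Set.disjoint_left]
    intro z hz1 hz2
    apply hne
    have key : i = j := by
      rcases lt_trichotomy i j with h | h | h
      · exfalso
        apply h4 i h
        rw [← ch_eq_of_mem t N h.le hz2, ch_eq_of_mem t N le_rfl hz1]
        exact h1
      · exact h
      · exfalso
        apply h2 j h
        rw [← ch_eq_of_mem t N h.le hz1, ch_eq_of_mem t N le_rfl hz2]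
        exact h3
    subst key
    rw [← ch_eq_of_mem t N le_rfl hz1, ch_eq_of_mem t N le_rfl hz2]
  have hcov : (⋃ P ∈ F, P.toSet) ⊆ ⋃ P ∈ F', P.toSet := by
    intro x hx
    simp only [mem_iUnion, exists_prop] at hx ⊢
    obtain ⟨P, hP, hxP⟩ := hx
    obtain ⟨j, y, rfl⟩ := hF P hP
    have hex : ∃ i, ch t N i x ∈ F := ⟨j, by rwa [ch_eq_of_mem t N le_rfl hxP]⟩
    exact ⟨ch t N (Nat.find hex) x, ⟨_, x, rfl, Nat.find_spec hex,
      fun i hi => Nat.find_min hex hi⟩, mem_self_ch _ _ _ _⟩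
  set c := 2 * avgE Q.toSet f with hc
  have hc0 : c ≠ 0 := by simp [hc, hne_zero]
  have hct : c ≠ ⊤ := ENNReal.mul_ne_top (by simp) hne_top
  have hone : ∀ P ∈ F, c * volume P.toSet ≤ ∫⁻ x in P.toSet, f x := by
    intro P hP
    have := (hlt P hP).le
    calc c * volume P.toSet ≤ avgE P.toSet f * volume P.toSet := by gcongr
      _ = (volume P.toSet)⁻¹ * volume P.toSet * ∫⁻ x in P.toSet, f x := by unfold avgE; ring
      _ = _ := by rw [ENNReal.inv_mul_cancel (volume_ne_zero P) (volume_ne_top P), one_mul]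
  have hmain : c * volume (⋃ P ∈ F, P.toSet) ≤ c * (volume Q.toSet / 2) := by
    calc c * volume (⋃ P ∈ F, P.toSet) ≤ c * volume (⋃ P ∈ F', P.toSet) := by gcongr
      _ ≤ c * ∑' P : F', volume P.1.toSet := by
          gcongr
          exact measure_biUnion_le _ hcount _
      _ = ∑' P : F', c * volume P.1.toSet := ENNReal.tsum_mul_left.symm
      _ ≤ ∑' P : F', ∫⁻ x in P.1.toSet, f x := by
          refine ENNReal.tsum_le_tsum fun P => hone _ ?_
          obtain ⟨_, _, _, h, _⟩ := P.2
          exact h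
      _ = ∫⁻ x in ⋃ P ∈ F', P.toSet, f x :=
          (lintegral_biUnion hcount (fun P _ => measurableSet_toSet P) hdisj f).symm
      _ ≤ ∫⁻ x in Q.toSet, f x := by
          refine lintegral_mono_set (iUnion₂_subset fun P hP => ?_)
          obtain ⟨_, _, _, h, _⟩ := hP
          exact hsub _ h
      _ = (volume Q.toSet)⁻¹ * volume Q.toSet * ∫⁻ x in Q.toSet, f x := by
          rw [ENNReal.inv_mul_cancel (volume_ne_zero Q) (volume_ne_top Q), one_mul]
      _ = (2 * 2⁻¹) * ((volume Q.toSet)⁻¹ * volume Q.toSet * ∫⁻ x in Q.toSet, f x) := by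
          rw [ENNReal.mul_inv_cancel (by simp) (by simp), one_mul]
      _ = c * (volume Q.toSet / 2) := by
          rw [hc, div_eq_mul_inv]; unfold avgE; ring
  exact (ENNReal.mul_le_mul_iff_right hc0 hct).1 hmain

lemma fam_sparse : IsSparse (fam t f N) := by
  intro Q hQ
  refine weak t f N Q _ ?_ (fun P hP => hP.2.1) (fun P hP => fam_strict t f N hP.1 hQ hP.2)
  rintro P ⟨⟨j, x, -, rfl⟩, -⟩
  exact ⟨j, x, rfl⟩

lemma rho_sum {ι : Type*} (X : BFS n) (s : Finset ι) (g : ι → Rn n → ℝ≥0∞) (B : ℝ≥0∞)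
    (h : ∀ i, X.ρ (g i) ≤ B) : X.ρ (fun x => ∑ i ∈ s, g i x) ≤ s.card * B := by
  classical
  induction s using Finset.induction_on with
  | empty =>
    have : X.ρ (fun _ => 0) = 0 := (X.zero_iff _).2 (Filter.EventuallyEq.refl _ _)
    simp [this]
  | insert a s ha ih =>
    simp only [Finset.sum_insert ha, Finset.card_insert_of_notMem ha]
    refine (X.add_le _ _).trans ?_
    push_cast
    rw [add_mul, one_mul, add_comm]
    exact add_le_add ih (h a)

end Aux

end SparseCZ

open SparseCZ in
/-- `‖Mf‖_X ≤ C sup_{D,S} ‖A_{D,S} f‖_X` for Banach function spaces. -/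
theorem stmt1 (n : ℕ) :
    ∃ C : ℝ≥0∞, C ≠ ⊤ ∧
      ∀ (X : BFS n) (f : Rn n → ℝ≥0∞), Measurable f →
        X.ρ (hlMax f) ≤
          C * ⨆ (D : Set (Cube n)) (_ : IsDyadicGrid D)
                (S : Set (Cube n)) (_ : S ⊆ D) (_ : IsSparse S), X.ρ (sparseOp S f) := by
  refine ⟨6 ^ n * ((Finset.univ : Finset (Fin n → Bool)).card * 2), ?_, ?_⟩
  · exact ENNReal.mul_ne_top (by simp) (ENNReal.mul_ne_top (by simp) (by simp))
  intro X f _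
  set B := ⨆ (D : Set (Cube n)) (_ : IsDyadicGrid D)
                (S : Set (Cube n)) (_ : S ⊆ D) (_ : IsSparse S), X.ρ (sparseOp S f) with hB
  have h1 : ∀ t : Fin n → Bool, X.ρ (fun x => ⨆ N, tM t f N x) ≤ 2 * B := by
    intro t
    have hmono : Monotone (tM t f) := by
      intro N N' h x
      refine iSup₂_le fun k hk => ?_
      exact le_iSup₂_of_le (f := fun (k : ℤ) (_ : k ≤ N') => avgE (qx t k x).toSet f) k
        (hk.trans (by exact_mod_cast h)) le_rfl
    rw [X.fatou _ hmono]
    refine iSup_le fun N => ?_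
    calc X.ρ (tM t f N) ≤ X.ρ (fun x => ((2:ℝ≥0) : ℝ≥0∞) * sparseOp (fam t f N) f x) :=
          X.mono _ _ (Filter.Eventually.of_forall fun x => by simpa using tM_le_sparse t f N x)
      _ = 2 * X.ρ (sparseOp (fam t f N) f) := by rw [X.smul_eq]; simp
      _ ≤ 2 * B := by
          gcongr
          exact le_iSup₂_of_le (grid t) (grid_isDyadic t)
            (le_iSup₂_of_le (fam t f N) (fam_sub t f N) (le_iSup_of_le (fam_sparse t f N) le_rfl))
  calc X.ρ (hlMax f)
      ≤ X.ρ (fun x => ((6 ^ n : ℝ≥0) : ℝ≥0∞) * ∑ t : Fin n → Bool, ⨆ N, tM t f N x) :=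
        X.mono _ _ (Filter.Eventually.of_forall fun x => by simpa using hlMax_le f x)
    _ = 6 ^ n * X.ρ (fun x => ∑ t : Fin n → Bool, ⨆ N, tM t f N x) := by
        rw [X.smul_eq]; simp
    _ ≤ 6 ^ n * ((Finset.univ : Finset (Fin n → Bool)).card * (2 * B)) := by
        gcongr
        exact rho_sum X _ _ _ h1
    _ = _ := by ring
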